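/- arXiv:2501.03205 — 12 statements merged into one kernel-verified Lean document; each statement's English description precedes it below -/
import Mathlib

section
/- Fix a natural number n ≥ 1. If an A_n Clebsch–Gordan datum φ satisfies the symmetry relations, the normalization relations, and the coherence relations, and moreover φ(i,j) ≠ 0 for all i,j ∈ ZMod(n+1), then φ lies in the gauge orbit of the reference datum φ⁽⁰⁾; that is, there exists g : ZMod(n+1) → ℂˣ with g(0) = 1 such that φ(i,j) = g(i+j)·g(i)⁻¹·g(j)⁻¹ for all i,j ∈ ZMod(n+1). -/
/-- The solution of `h (b + 1) = c * φ (b, 1) * h b` with `h 0 = 1` trivializes the cocycle `φ`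
along the natural numbers. -/
theorem cocycle_trivialization_natCast {R K : Type*} [Semiring R] [Field K]
    (φ : R × R → K) (hzero : ∀ i, φ (i, 0) = 1)
    (hcoh : ∀ i j k, φ (i + j, k) * φ (i, j) = φ (i, j + k) * φ (j, k))
    (c : K) (a b : ℕ) :
    c ^ (a + b) * ∏ m ∈ Finset.range (a + b), φ ((m : R), 1) =
      φ ((a : R), (b : R)) * (c ^ a * ∏ m ∈ Finset.range a, φ ((m : R), 1)) *
        (c ^ b * ∏ m ∈ Finset.range b, φ ((m : R), 1)) := by
  induction b with
  | zero => simp [hzero]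
  | succ b ih =>
    have h := hcoh (a : R) (b : R) 1
    rw [← add_assoc, pow_succ, Finset.prod_range_succ, pow_succ, Finset.prod_range_succ]
    push_cast
    linear_combination c * φ ((a : R) + (b : R), 1) * ih +
      c * (c ^ a * ∏ m ∈ Finset.range a, φ ((m : R), 1)) *
        (c ^ b * ∏ m ∈ Finset.range b, φ ((m : R), 1)) * h

/-- A nowhere-vanishing A_n Clebsch–Gordan datum satisfying the symmetry,
normalization and coherence relations lies in the gauge orbit of the reference datum. -/
theorem stmt_1 (n : ℕ) (hn : 1 ≤ n)
    (φ : ZMod (n + 1) × ZMod (n + 1) → ℂ)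
    (hsym : ∀ i j : ZMod (n + 1), φ (i, j) = φ (j, i))
    (hnorm : ∀ j : ZMod (n + 1), φ (0, j) = 1)
    (hcoh : ∀ i j k : ZMod (n + 1),
      φ (i + j, k) * φ (i, j) = φ (i, j + k) * φ (j, k))
    (hne : ∀ i j : ZMod (n + 1), φ (i, j) ≠ 0) :
    ∃ g : ZMod (n + 1) → ℂˣ, g 0 = 1 ∧
      ∀ i j : ZMod (n + 1),
        φ (i, j) = (g (i + j) : ℂ) * ((g i : ℂ))⁻¹ * ((g j : ℂ))⁻¹ := by
  have hzero (i : ZMod (n + 1)) : φ (i, 0) = 1 := by rw [hsym, hnorm]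
  obtain ⟨c, hc⟩ := IsAlgClosed.exists_pow_nat_eq
    (∏ m ∈ Finset.range (n + 1), φ ((m : ZMod (n + 1)), 1))⁻¹ n.succ_pos
  have hprod (k : ℕ) : ∏ m ∈ Finset.range k, φ ((m : ZMod (n + 1)), 1) ≠ 0 :=
    Finset.prod_ne_zero_iff.mpr fun m _ => hne m 1
  have hc0 : c ≠ 0 := by
    rintro rfl
    rw [zero_pow n.succ_ne_zero] at hc
    exact inv_ne_zero (hprod (n + 1)) hc.symm
  set h : ℕ → ℂ := fun k => c ^ k * ∏ m ∈ Finset.range k, φ ((m : ZMod (n + 1)), 1) with h_def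
  have h_add (a b : ℕ) : h (a + b) = φ ((a : ZMod (n + 1)), (b : ZMod (n + 1))) * h a * h b :=
    cocycle_trivialization_natCast φ hzero hcoh c a b
  have h_ne (k : ℕ) : h k ≠ 0 := mul_ne_zero (pow_ne_zero k hc0) (hprod k)
  have h_card : h (n + 1) = 1 := by
    simp only [h_def, hc]
    exact inv_mul_cancel₀ (hprod (n + 1))
  have h_periodic : Function.Periodic h (n + 1) := fun a => by
    rw [h_add, ZMod.natCast_self, hzero, h_card, one_mul, mul_one]
  refine ⟨fun i => Units.mk0 (h i.val) (h_ne _), ?_, fun i j => ?_⟩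
  · ext
    simp [h_def]
  · have hi := h_ne i.val
    have hj := h_ne j.val
    simp only [Units.val_mk0]
    rw [ZMod.val_add, h_periodic.map_mod_nat, h_add, ZMod.natCast_zmod_val, ZMod.natCast_zmod_val]
    field_simp
end

section
/- Fix a natural number n ≥ 1, let ζ = exp(2π·I/(n+1)) ∈ ℂ, and let σ* be the ℂ-algebra endomorphism of the polynomial ring ℂ[X,Y] (i.e. MvPolynomial (Fin 2) ℂ) determined by X ↦ ζ·X and Y ↦ ζ⁻¹·Y. Then the set of polynomials p ∈ ℂ[X,Y] with σ*(p) = p is exactly the ℂ-subalgebra of ℂ[X,Y] generated by the three elements X^{n+1}, Y^{n+1} and X·Y (i.e. Algebra.adjoin ℂ {X^{n+1}, Y^{n+1}, X·Y}). -/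
open MvPolynomial

/-- Rescaling the variables rescales each coefficient. -/
theorem coeff_aeval_smul_X {ι R : Type*} [CommSemiring R] (c : ι → R)
    (p : MvPolynomial ι R) (d : ι →₀ ℕ) :
    coeff d (aeval (fun i => c i • (X i : MvPolynomial ι R)) p) =
      (d.prod fun i k => c i ^ k) * coeff d p := by
  classical
  induction p using MvPolynomial.induction_on' with
  | monomial e r =>
    have h : aeval (fun i => c i • (X i : MvPolynomial ι R)) (monomial e r) =
        monomial e (r * e.prod fun i k => c i ^ k) := by
      rw [aeval_monomial, monomial_eq, algebraMap_eq, C_mul, mul_assoc]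
      simp only [Finsupp.prod, smul_eq_C_mul, mul_pow, Finset.prod_mul_distrib, map_prod, map_pow]
    rw [h, coeff_monomial, coeff_monomial]
    split_ifs with hed
    · rw [hed, mul_comm]
    · rw [mul_zero]
  | add p q hp hq => rw [map_add, coeff_add, coeff_add, hp, hq, mul_add]

/-- If `a ≡ b [MOD m]`, then `x ^ a * y ^ b` lies in the subalgebra generated by
`x ^ m`, `y ^ m` and `x * y`. -/
theorem pow_mul_pow_mem_adjoin_of_modEq {R A : Type*} [CommSemiring R] [CommSemiring A]
    [Algebra R A] (x y : A) {m a b : ℕ} (h : a ≡ b [MOD m]) :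
    x ^ a * y ^ b ∈ Algebra.adjoin R {x ^ m, y ^ m, x * y} := by
  have hx : x ^ m ∈ Algebra.adjoin R {x ^ m, y ^ m, x * y} :=
    Algebra.subset_adjoin (by simp)
  have hy : y ^ m ∈ Algebra.adjoin R {x ^ m, y ^ m, x * y} :=
    Algebra.subset_adjoin (by simp)
  have hxy : x * y ∈ Algebra.adjoin R {x ^ m, y ^ m, x * y} :=
    Algebra.subset_adjoin (by simp)
  rcases le_total a b with hab | hab
  · obtain ⟨k, hk⟩ := (Nat.modEq_iff_dvd' hab).1 h
    obtain rfl : b = a + m * k := by omega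
    rw [pow_add, ← mul_assoc, ← mul_pow, pow_mul]
    exact mul_mem (pow_mem hxy _) (pow_mem hy _)
  · obtain ⟨k, hk⟩ := (Nat.modEq_iff_dvd' hab).1 h.symm
    obtain rfl : a = b + m * k := by omega
    rw [pow_add, mul_right_comm, ← mul_pow, pow_mul]
    exact mul_mem (pow_mem hxy _) (pow_mem hx _)

theorem IsPrimitiveRoot.modEq_of_pow_mul_inv_pow_eq_one {K : Type*} [Field K] {ζ : K} {m a b : ℕ}
    (hζ : IsPrimitiveRoot ζ m) (hm : m ≠ 0) (h : ζ ^ a * ζ⁻¹ ^ b = 1) : a ≡ b [MOD m] := by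
  have hb : ζ ^ b ≠ 0 := pow_ne_zero _ (hζ.ne_zero hm)
  rw [inv_pow, mul_inv_eq_one₀ hb] at h
  rw [hζ.eq_orderOf]
  exact (hζ.isOfFinOrder hm).pow_eq_pow_iff_modEq.1 h

/-- The fixed polynomials of the A_n action `X ↦ ζX, Y ↦ ζ⁻¹Y`
(with `ζ = exp(2πI/(n+1))`) on `ℂ[X,Y]` are exactly the subalgebra generated by
`X^{n+1}`, `Y^{n+1}` and `X·Y`. -/
theorem stmt_3 (n : ℕ) (hn : 1 ≤ n)
    (ζ : ℂ) (hζ : ζ = Complex.exp (2 * (Real.pi : ℂ) * Complex.I / ((n : ℂ) + 1)))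
    (σstar : MvPolynomial (Fin 2) ℂ →ₐ[ℂ] MvPolynomial (Fin 2) ℂ)
    (hσ : σstar = aeval (fun i : Fin 2 =>
      if i = 0 then ζ • (X 0 : MvPolynomial (Fin 2) ℂ) else ζ⁻¹ • X 1)) :
    {p : MvPolynomial (Fin 2) ℂ | σstar p = p} =
      (Algebra.adjoin ℂ
        {(X 0 : MvPolynomial (Fin 2) ℂ) ^ (n + 1), (X 1 : MvPolynomial (Fin 2) ℂ) ^ (n + 1),
          (X 0 : MvPolynomial (Fin 2) ℂ) * X 1} : Subalgebra ℂ (MvPolynomial (Fin 2) ℂ)) := by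
  have hprim : IsPrimitiveRoot ζ (n + 1) := by
    rw [hζ]
    exact_mod_cast Complex.isPrimitiveRoot_exp (n + 1) n.succ_ne_zero
  have hζ0 : ζ ≠ 0 := hprim.ne_zero n.succ_ne_zero
  have hX : σstar (X 0) = ζ • X 0 := by simp [hσ]
  have hY : σstar (X 1) = ζ⁻¹ • X 1 := by simp [hσ]
  have hσ' : σstar = aeval (fun i => (![ζ, ζ⁻¹] i) • (X i : MvPolynomial (Fin 2) ℂ)) := by
    ext1 i
    fin_cases i
    · simpa using hX
    · simpa using hY
  apply Set.Subset.antisymm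
  · intro p hp
    rw [SetLike.mem_coe, p.as_sum]
    refine sum_mem fun d hd => ?_
    have hcoeff : ζ ^ d 0 * ζ⁻¹ ^ d 1 = 1 := by
      have h := coeff_aeval_smul_X ![ζ, ζ⁻¹] p d
      rw [← hσ', hp.out, Finsupp.prod_fintype _ _ (by simp), Fin.prod_univ_two] at h
      exact (right_eq_mul₀ (mem_support_iff.1 hd)).1 h
    rw [monomial_eq, ← smul_eq_C_mul, Finsupp.prod_fintype _ _ (by simp), Fin.prod_univ_two]
    exact Subalgebra.smul_mem _ (pow_mul_pow_mem_adjoin_of_modEq _ _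
      (hprim.modEq_of_pow_mul_inv_pow_eq_one n.succ_ne_zero hcoeff)) _
  · change Algebra.adjoin ℂ _ ≤ AlgHom.equalizer σstar (AlgHom.id ℂ _)
    rw [Algebra.adjoin_le_iff]
    rintro _ (rfl | rfl | rfl)
    · simp [hX, smul_pow, hprim.pow_eq_one]
    · simp [hY, smul_pow, hprim.pow_eq_one]
    · simp [hX, hY, smul_smul, hζ0]
end

section
/- Fix a natural number n ≥ 1. The kernel of the ℂ-algebra homomorphism from the polynomial ring ℂ[a,b,c] (i.e. MvPolynomial (Fin 3) ℂ) to the polynomial ring ℂ[X,Y] (i.e. MvPolynomial (Fin 2) ℂ) determined by a ↦ X^{n+1}, b ↦ Y^{n+1}, c ↦ X·Y equals the ideal generated by the single element a·b − c^{n+1}. -/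
open MvPolynomial

/-- A monomial lift of `X ^ i * Y ^ j` along `a ↦ X ^ m`, `b ↦ Y ^ m`, `c ↦ X * Y`
(meaningful when `m` divides the difference of `i` and `j`), with values in an algebra with chosen
elements `a`, `b`, `c`. -/
def monomialLift {A : Type*} [CommRing A] (a b c : A) (m i j : ℕ) : A :=
  c ^ min i j * a ^ ((i - j) / m) * b ^ ((j - i) / m)

theorem monomialLift_of_mul_eq_pow {A : Type*} [CommRing A] {a b c : A} {m : ℕ} (hm : 0 < m)
    (h : a * b = c ^ m) (p q r : ℕ) :
    monomialLift a b c m (m * p + r) (m * q + r) = a ^ p * b ^ q * c ^ r := by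
  unfold monomialLift
  rw [Nat.add_sub_add_right, Nat.add_sub_add_right, ← Nat.mul_sub, ← Nat.mul_sub,
    Nat.mul_div_cancel_left _ hm, Nat.mul_div_cancel_left _ hm, Nat.add_min_add_right]
  rcases le_total p q with hpq | hpq
  · obtain ⟨d, rfl⟩ := Nat.exists_eq_add_of_le hpq
    rw [min_eq_left (Nat.mul_le_mul_left m hpq), Nat.sub_eq_zero_of_le hpq,
      Nat.add_sub_cancel_left, pow_add c, pow_mul c, ← h]
    ring
  · obtain ⟨d, rfl⟩ := Nat.exists_eq_add_of_le hpq
    rw [min_eq_right (Nat.mul_le_mul_left m hpq), Nat.sub_eq_zero_of_le hpq,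
      Nat.add_sub_cancel_left, pow_add c, pow_mul c, ← h]
    ring

theorem ker_aeval_pow_pow_mul (R : Type*) [CommRing R] {m : ℕ} (hm : 0 < m) :
    RingHom.ker (aeval (R := R) (fun i : Fin 3 =>
        if i = 0 then (X 0 : MvPolynomial (Fin 2) R) ^ m
        else if i = 1 then (X 1 : MvPolynomial (Fin 2) R) ^ m
        else (X 0 : MvPolynomial (Fin 2) R) * X 1) :
      MvPolynomial (Fin 3) R →ₐ[R] MvPolynomial (Fin 2) R) =
    Ideal.span {(X 0 : MvPolynomial (Fin 3) R) * X 1 - (X 2 : MvPolynomial (Fin 3) R) ^ m} := by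
  set φ := (aeval (R := R) (fun i : Fin 3 =>
        if i = 0 then (X 0 : MvPolynomial (Fin 2) R) ^ m
        else if i = 1 then (X 1 : MvPolynomial (Fin 2) R) ^ m
        else (X 0 : MvPolynomial (Fin 2) R) * X 1) :
      MvPolynomial (Fin 3) R →ₐ[R] MvPolynomial (Fin 2) R) with hφ
  set I := Ideal.span
    {(X 0 : MvPolynomial (Fin 3) R) * X 1 - (X 2 : MvPolynomial (Fin 3) R) ^ m} with hI
  apply le_antisymm
  · let π := Ideal.Quotient.mkₐ R I
    have hrel : π (X 0) * π (X 1) = π (X 2) ^ m := by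
      rw [← map_mul, ← map_pow]
      exact Ideal.Quotient.eq.mpr (Ideal.subset_span rfl)
    let s : MvPolynomial (Fin 2) R →ₗ[R] MvPolynomial (Fin 3) R ⧸ I :=
      (basisMonomials (Fin 2) R).constr R fun v =>
        monomialLift (π (X 0)) (π (X 1)) (π (X 2)) m (v 0) (v 1)
    have hs (v : Fin 2 →₀ ℕ) : s (monomial v 1) =
        monomialLift (π (X 0)) (π (X 1)) (π (X 2)) m (v 0) (v 1) := by
      simpa only [coe_basisMonomials] using (basisMonomials (Fin 2) R).constr_basis R _ v
    have hcomp : s ∘ₗ φ.toLinearMap = π.toLinearMap := by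
      refine (basisMonomials (Fin 3) R).ext fun v => ?_
      have hv : φ (monomial v 1) = monomial
          (Finsupp.single 0 (m * v 0 + v 2) + Finsupp.single 1 (m * v 1 + v 2)) 1 := by
        rw [← mul_one (1 : R), ← monomial_mul, ← X_pow_eq_monomial, ← X_pow_eq_monomial]
        rw [hφ, aeval_monomial]
        simp [Finsupp.prod_fintype, Fin.prod_univ_three]
        ring
      have hπ : π (monomial v 1) = π (X 0) ^ v 0 * π (X 1) ^ v 1 * π (X 2) ^ v 2 := by
        rw [monomial_eq]
        simp [Finsupp.prod_fintype, Fin.prod_univ_three]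
      simp only [coe_basisMonomials, LinearMap.comp_apply, AlgHom.toLinearMap_apply]
      rw [hv, hs, hπ, ← monomialLift_of_mul_eq_pow hm hrel]
      simp
    intro f hf
    have h := LinearMap.congr_fun hcomp f
    simp only [LinearMap.comp_apply, AlgHom.toLinearMap_apply] at h
    rw [(RingHom.mem_ker).mp hf, map_zero] at h
    exact Ideal.Quotient.eq_zero_iff_mem.mp h.symm
  · rw [hI, Ideal.span_singleton_le_iff_mem, RingHom.mem_ker]
    simp [hφ, mul_pow]

/-- The kernel of the map `ℂ[a,b,c] → ℂ[X,Y]`, `a ↦ X^{n+1}`,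
`b ↦ Y^{n+1}`, `c ↦ X·Y`, is the ideal generated by `a·b − c^{n+1}`. -/
theorem stmt_4 (n : ℕ) (hn : 1 ≤ n) :
    RingHom.ker (aeval (R := ℂ) (fun i : Fin 3 =>
        if i = 0 then (X 0 : MvPolynomial (Fin 2) ℂ) ^ (n + 1)
        else if i = 1 then (X 1 : MvPolynomial (Fin 2) ℂ) ^ (n + 1)
        else (X 0 : MvPolynomial (Fin 2) ℂ) * X 1) :
      MvPolynomial (Fin 3) ℂ →ₐ[ℂ] MvPolynomial (Fin 2) ℂ) =
    Ideal.span {(X 0 : MvPolynomial (Fin 3) ℂ) * X 1 - (X 2 : MvPolynomial (Fin 3) ℂ) ^ (n + 1)} := by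
  exact ker_aeval_pow_pow_mul ℂ n.succ_pos
end

section
/- Fix a natural number n ≥ 1 and let φ : ZMod(n+1) × ZMod(n+1) → ℂ satisfy the symmetry relations, the normalization relations and the coherence relations. Define α : {0,1,…,n} → ℕ by α(0) = 0 and, for 1 ≤ i ≤ n: α(i) = j₀ + 1 where j₀ is the largest index with 1 ≤ j₀ ≤ i−1 and φ(j₀,1) = 0 (indices read as their residues in ZMod(n+1)), and α(i) = 1 if φ(j,1) ≠ 0 for all 1 ≤ j ≤ i−1. Then for all 1 ≤ i, j ≤ n with φ(i,j) ≠ 0 one has α(r) ≤ α(i) + α(j), where r ∈ {0,1,…,n} is the residue of i+j modulo n+1. -/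
/-- Under coherence, if `φ (i, j) ≠ 0` and `φ (k, 1) ≠ 0` for `b ≤ k < j`, then `φ (i, b) ≠ 0`
and `φ (i + k, 1) ≠ 0` for `b ≤ k < j`. -/
theorem coherent_descent {R M : Type*} [AddMonoidWithOne R] [MulZeroClass M] [NoZeroDivisors M]
    {φ : R × R → M}
    (hcoh : ∀ i j k : R, φ (i + j, k) * φ (i, j) = φ (i, j + k) * φ (j, k))
    (i : R) {b j : ℕ} (hbj : b ≤ j) (hb : ∀ k : ℕ, b ≤ k → k < j → φ ((k : R), 1) ≠ 0)
    (hij : φ (i, (j : R)) ≠ 0) :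
    φ (i, (b : R)) ≠ 0 ∧ ∀ k : ℕ, b ≤ k → k < j → φ (i + (k : R), 1) ≠ 0 := by
  induction j, hbj using Nat.le_induction with
  | base => exact ⟨hij, fun k h1 h2 => absurd h2 (by omega)⟩
  | succ j hbj ih =>
    have hprod : φ (i + (j : R), 1) * φ (i, (j : R)) ≠ 0 := by
      rw [hcoh]
      exact mul_ne_zero (by simpa using hij) (hb j hbj (by omega))
    obtain ⟨hφb, hφk⟩ := ih (fun k h1 h2 => hb k h1 (by omega)) (right_ne_zero_of_mul hprod)
    refine ⟨hφb, fun k h1 h2 => ?_⟩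
    rcases Nat.lt_succ_iff_lt_or_eq.mp h2 with h | rfl
    · exact hφk k h1 h
    · exact left_ne_zero_of_mul hprod

/-- Superadditivity of the exponents `α` in the A_n case (`x_n = 0`):
if `φ` is an A_n Clebsch–Gordan datum satisfying symmetry, normalization and coherence,
and `α(i) = (largest 1 ≤ j₀ ≤ i−1 with φ(j₀,1) = 0) + 1` (and `α(i) = 1` when no such
`j₀` exists, `α(0) = 0`), then `φ(i,j) ≠ 0` implies `α((i+j) mod (n+1)) ≤ α(i) + α(j)`. -/
theorem stmt_7 (n : ℕ) (hn : 1 ≤ n)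
    (φ : ZMod (n + 1) × ZMod (n + 1) → ℂ)
    (hsym : ∀ i j : ZMod (n + 1), φ (i, j) = φ (j, i))
    (hnorm : ∀ j : ZMod (n + 1), φ (0, j) = 1)
    (hcoh : ∀ i j k : ZMod (n + 1),
      φ (i + j, k) * φ (i, j) = φ (i, j + k) * φ (j, k))
    (α : ℕ → ℕ)
    (hα0 : α 0 = 0)
    (hα : ∀ i : ℕ, 1 ≤ i → i ≤ n →
      α i = sSup {j : ℕ | 1 ≤ j ∧ j ≤ i - 1 ∧ φ ((j : ZMod (n + 1)), 1) = 0} + 1) :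
    ∀ i j : ℕ, 1 ≤ i → i ≤ n → 1 ≤ j → j ≤ n →
      φ ((i : ZMod (n + 1)), (j : ZMod (n + 1))) ≠ 0 →
      α ((i + j) % (n + 1)) ≤ α i + α j := by
  have α_pos : ∀ i, 1 ≤ i → i ≤ n → 1 ≤ α i := fun i h1 h2 => by
    rw [hα i h1 h2]; omega
  have α_le : ∀ i c : ℕ, 1 ≤ i → i ≤ n → 1 ≤ c →
      (∀ k : ℕ, c ≤ k → k < i → φ ((k : ZMod (n + 1)), 1) ≠ 0) → α i ≤ c := by
    intro i c h1 h2 hc h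
    rw [hα i h1 h2]
    have : sSup {j : ℕ | 1 ≤ j ∧ j ≤ i - 1 ∧ φ ((j : ZMod (n + 1)), 1) = 0} ≤ c - 1 := by
      refine csSup_le' ?_
      rintro k ⟨hk1, hk2, hk3⟩
      by_contra hlt
      exact h k (by omega) (by omega) hk3
    omega
  have α_le_self : ∀ i, 1 ≤ i → i ≤ n → α i ≤ i := fun i h1 h2 =>
    α_le i i h1 h2 h1 fun k h3 h4 => absurd h4 (by omega)
  have ne_zero_of_α_le : ∀ i, 1 ≤ i → i ≤ n →
      ∀ k : ℕ, α i ≤ k → k < i → φ ((k : ZMod (n + 1)), 1) ≠ 0 := by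
    intro i h1 h2 k h3 h4 h0
    have hpos := α_pos i h1 h2
    rw [hα i h1 h2] at h3
    have : k ≤ sSup {j : ℕ | 1 ≤ j ∧ j ≤ i - 1 ∧ φ ((j : ZMod (n + 1)), 1) = 0} :=
      le_csSup ⟨i - 1, fun _ h => h.2.1⟩ ⟨by omega, by omega, h0⟩
    omega
  intro i j hi hin hj hjn hij
  have hαi := α_pos i hi hin
  have hαj := α_pos j hj hjn
  obtain ⟨h1, hx1⟩ := coherent_descent hcoh _ (α_le_self j hj hjn) (ne_zero_of_α_le j hj hjn) hij
  rw [hsym] at h1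
  obtain ⟨-, hx2⟩ := coherent_descent hcoh _ (α_le_self i hi hin) (ne_zero_of_α_le i hi hin) h1
  have hx : ∀ k : ℕ, α i + α j ≤ k → k < i + j → φ ((k : ZMod (n + 1)), 1) ≠ 0 := by
    intro k hk1 hk2
    rcases lt_or_ge k (i + α j) with h | h
    · have := hx2 (k - α j) (by omega) (by omega)
      rwa [← Nat.cast_add, Nat.add_sub_cancel' (by omega)] at this
    · have := hx1 (k - i) (by omega) (by omega)
      rwa [← Nat.cast_add, Nat.add_sub_cancel' (by omega)] at this
  rcases Nat.lt_or_ge (i + j) (n + 1) with h | h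
  · rw [Nat.mod_eq_of_lt h]
    exact α_le _ _ (by omega) (by omega) (by omega) hx
  · obtain ⟨r, hr⟩ := Nat.exists_eq_add_of_le h
    have hrn : r < n := by omega
    rw [hr, Nat.add_mod_left, Nat.mod_eq_of_lt (by omega)]
    rcases Nat.eq_zero_or_pos r with rfl | hr0
    · simp [hα0]
    rcases Nat.lt_or_ge n (α i + α j) with hab | hab
    · exact (α_le_self r hr0 hrn.le).trans (by omega)
    · refine (α_le r 1 hr0 hrn.le le_rfl fun k _ hk => ?_).trans (by omega)
      have hk' := hx (n + 1 + k) (by omega) (by omega)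
      rwa [Nat.cast_add, ZMod.natCast_self, zero_add] at hk'
end

section
/- Fix a natural number n ≥ 1 and an integer k with 1 ≤ k ≤ n+1. Define α : {0,1,…,n} → ℤ by α(0) = 0, α(i) = −i·(n−k+1) for 1 ≤ i ≤ k−1, and α(i) = −(n−i+1)·(k−1) for k ≤ i ≤ n. Then for all 0 ≤ i, j ≤ n one has α(i) + α(j) ≤ α(r), where r ∈ {0,1,…,n} is the residue of i+j modulo n+1. -/
/-- Superadditivity of the exponent vector of the `k`-th one-parameter
family in the A_n nullcone: with `α(0) = 0`, `α(i) = −i(n−k+1)` for `1 ≤ i ≤ k−1` and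
`α(i) = −(n−i+1)(k−1)` for `k ≤ i ≤ n`, one has `α(i) + α(j) ≤ α((i+j) mod (n+1))`. -/
theorem stmt_8 (n : ℕ) (hn : 1 ≤ n) (k : ℕ) (hk1 : 1 ≤ k) (hk2 : k ≤ n + 1)
    (α : ℕ → ℤ)
    (hα0 : α 0 = 0)
    (hα1 : ∀ i : ℕ, 1 ≤ i → i ≤ k - 1 → α i = -(i : ℤ) * ((n : ℤ) - (k : ℤ) + 1))
    (hα2 : ∀ i : ℕ, k ≤ i → i ≤ n → α i = -((n : ℤ) - (i : ℤ) + 1) * ((k : ℤ) - 1)) :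
    ∀ i j : ℕ, i ≤ n → j ≤ n → α i + α j ≤ α ((i + j) % (n + 1)) := by
  obtain ⟨a, rfl⟩ : ∃ a, k = a + 1 := ⟨k - 1, by omega⟩
  obtain ⟨b, rfl⟩ : ∃ b, n = a + b := ⟨n - a, by omega⟩
  -- `-α` is the minimum of the two linear functions `m ↦ m b` and `m ↦ (a + b + 1 - m) a`.
  have key : ∀ m : ℕ, m ≤ a + b →
      -((m : ℤ) * b) ≤ α m ∧ -(((a : ℤ) + b + 1 - m) * a) ≤ α m ∧
        (α m = -((m : ℤ) * b) ∨ α m = -(((a : ℤ) + b + 1 - m) * a)) := by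
    intro m hm
    rcases Nat.lt_or_ge a m with h | h
    · have e : α m = -(((a : ℤ) + b + 1 - m) * a) := by
        rw [hα2 m h hm]; push_cast; ring
      refine ⟨?_, e.ge, Or.inr e⟩
      have h' : (a : ℤ) + 1 ≤ m := by exact_mod_cast h
      rw [e]
      nlinarith [mul_nonneg (sub_nonneg.2 h') (by positivity : (0 : ℤ) ≤ (a : ℤ) + b)]
    · have e : α m = -((m : ℤ) * b) := by
        rcases Nat.eq_zero_or_pos m with rfl | h0
        · simp [hα0]
        · rw [hα1 m h0 (by omega)]; push_cast; ring
      refine ⟨e.ge, ?_, Or.inl e⟩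
      have h' : (m : ℤ) ≤ a := by exact_mod_cast h
      rw [e]
      nlinarith [mul_nonneg (sub_nonneg.2 h') (by positivity : (0 : ℤ) ≤ (a : ℤ) + b)]
  intro i j hi hj
  have ha : (0 : ℤ) ≤ a := by positivity
  have hb : (0 : ℤ) ≤ b := by positivity
  have hi' : (i : ℤ) ≤ a + b := by exact_mod_cast hi
  have hj' : (j : ℤ) ≤ a + b := by exact_mod_cast hj
  have hi0 : (0 : ℤ) ≤ i := by positivity
  have hj0 : (0 : ℤ) ≤ j := by positivity
  obtain ⟨-, -, ei⟩ := key i hi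
  obtain ⟨-, -, ej⟩ := key j hj
  obtain ⟨r1, r2, -⟩ :=
    key ((i + j) % (a + b + 1)) (Nat.lt_succ_iff.1 (Nat.mod_lt _ (Nat.succ_pos _)))
  generalize α ((i + j) % (a + b + 1)) = x at *
  have hr : (((i + j) % (a + b + 1) : ℕ) : ℤ) = i + j ∨
      (((i + j) % (a + b + 1) : ℕ) : ℤ) = i + j - (a + b + 1) := by
    rcases Nat.lt_or_ge (i + j) (a + b + 1) with h | h
    · rw [Nat.mod_eq_of_lt h]; left; push_cast; rfl
    · rw [Nat.mod_eq_sub_mod h, Nat.mod_eq_of_lt (by omega)]; right; omega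
  have pi : 0 ≤ ((a : ℤ) + b + 1 - i) * a := mul_nonneg (by linarith) ha
  have pj : 0 ≤ ((a : ℤ) + b + 1 - j) * a := mul_nonneg (by linarith) ha
  have qi : 0 ≤ ((a : ℤ) + b + 1 - i) * b := mul_nonneg (by linarith) hb
  have qj : 0 ≤ ((a : ℤ) + b + 1 - j) * b := mul_nonneg (by linarith) hb
  have := mul_nonneg hi0 ha
  have := mul_nonneg hj0 ha
  have := mul_nonneg hi0 hb
  have := mul_nonneg hj0 hb
  rcases hr with hr | hr <;> rw [hr] at r1 r2 <;> rcases ei with ei | ei <;>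
    rcases ej with ej | ej <;> rw [ei, ej] <;> linarith
end

section
/- Let β, α₁, α₂, α₃ ∈ ℂ, let A = diag(α₁, α₂, α₃), let F = diag(2, 4, 2), and let B be a 3×3 matrix over ℂ. If condition (E3) holds, i.e. (∧²B) · F⁻¹ = β · A · B, then det(B)² = −16·β³·α₁·α₂·α₃·det(B). In particular, if moreover det(B) ≠ 0, then det(B) = −16·β³·α₁·α₂·α₃. -/
open Matrix

/-- The matrix of 2×2 minors of a 3×3 matrix. -/
def wedgeTwo (B : Matrix (Fin 3) (Fin 3) ℂ) : Matrix (Fin 3) (Fin 3) ℂ :=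
  !![B 1 0 * B 2 1 - B 2 0 * B 1 1, B 1 0 * B 2 2 - B 2 0 * B 1 2, B 1 1 * B 2 2 - B 2 1 * B 1 2;
     B 0 0 * B 2 1 - B 2 0 * B 0 1, B 0 0 * B 2 2 - B 2 0 * B 0 2, B 0 1 * B 2 2 - B 2 1 * B 0 2;
     B 0 0 * B 1 1 - B 1 0 * B 0 1, B 0 0 * B 1 2 - B 1 0 * B 0 2, B 0 1 * B 1 2 - B 1 1 * B 0 2]

/-- The rows of `wedgeTwo` are in reverse order compared to the second compound matrix,
hence the sign. -/
theorem det_wedgeTwo (B : Matrix (Fin 3) (Fin 3) ℂ) : (wedgeTwo B).det = -B.det ^ 2 := by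
  simp only [wedgeTwo, Matrix.det_fin_three, Matrix.of_apply, Matrix.cons_val]
  ring

/-- With `A = diag(α₁,α₂,α₃)` and `F = diag(2,4,2)`, condition (E3)
`(∧²B)·F⁻¹ = β·A·B` implies `det(B)² = −16·β³·α₁·α₂·α₃·det(B)`; in particular if
`det(B) ≠ 0` then `det(B) = −16·β³·α₁·α₂·α₃`. -/
theorem stmt_11 (β α₁ α₂ α₃ : ℂ) (B : Matrix (Fin 3) (Fin 3) ℂ)
    (A : Matrix (Fin 3) (Fin 3) ℂ) (hA : A = Matrix.diagonal ![α₁, α₂, α₃])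
    (F : Matrix (Fin 3) (Fin 3) ℂ) (hF : F = Matrix.diagonal ![2, 4, 2])
    (hE3 : wedgeTwo B * F⁻¹ = β • (A * B)) :
    B.det ^ 2 = -16 * β ^ 3 * α₁ * α₂ * α₃ * B.det ∧
    (B.det ≠ 0 → B.det = -16 * β ^ 3 * α₁ * α₂ * α₃) := by
  have hFdet : F.det = 16 := by
    rw [hF, Matrix.det_diagonal, Fin.prod_univ_three]
    simp only [Matrix.cons_val]
    norm_num
  have hAdet : A.det = α₁ * α₂ * α₃ := by
    rw [hA, Matrix.det_diagonal, Fin.prod_univ_three]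
    simp only [Matrix.cons_val]
  have hdet := congrArg Matrix.det hE3
  rw [Matrix.det_mul, Matrix.det_nonsing_inv, Matrix.det_smul, Matrix.det_mul, det_wedgeTwo,
    hFdet, hAdet, Ring.inverse_eq_inv', Fintype.card_fin] at hdet
  have hsq : B.det ^ 2 = -16 * β ^ 3 * α₁ * α₂ * α₃ * B.det := by
    linear_combination (-16) * hdet
  exact ⟨hsq, fun h => mul_right_cancel₀ h (by rw [← hsq, sq])⟩
end

section
/- Let β, α₁, α₂, α₃ ∈ ℂ, let A = diag(α₁, α₂, α₃), let F = diag(2, 4, 2), let S = diag(−1, 1, −1), let σ be the antidiagonal permutation matrix with rows (0,0,1), (0,1,0), (1,0,0), and let B be a 3×3 matrix over ℂ with det(B) ≠ 0. If condition (E3) holds, i.e. (∧²B) · F⁻¹ = β · A · B, then also (E1): Bᵀ · A · (S · B · σ · S · F) = −16·α₁·α₂·α₃·β² · I₃ and (E2): (S · B · σ · S · F) · Bᵀ · A = −16·α₁·α₂·α₃·β² · I₃. -/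
open Matrix

/-- The adjugate is the transpose of the matrix of minors, reindexed by `σ` and with signs `S`. -/
theorem adjugate_eq_transpose_wedgeTwo (B : Matrix (Fin 3) (Fin 3) ℂ) :
    B.adjugate = (diagonal ![-1, 1, -1] * wedgeTwo B * !![0, 0, 1; 0, 1, 0; 1, 0, 0] *
      diagonal ![-1, 1, -1])ᵀ := by
  rw [adjugate_fin_three]
  ext i j
  fin_cases i <;> fin_cases j <;>
    simp [wedgeTwo, Matrix.mul_apply, Fin.sum_univ_three, diagonal_apply] <;> ring

/-- For invertible `B`, condition (E3) `(∧²B)·F⁻¹ = β·A·B` implies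
conditions (E1) `Bᵀ·A·(S·B·σ·S·F) = −16·α₁α₂α₃β²·I₃` and
(E2) `(S·B·σ·S·F)·Bᵀ·A = −16·α₁α₂α₃β²·I₃`. -/
theorem stmt_12 (β α₁ α₂ α₃ : ℂ) (B : Matrix (Fin 3) (Fin 3) ℂ) (hB : B.det ≠ 0)
    (A : Matrix (Fin 3) (Fin 3) ℂ) (hA : A = Matrix.diagonal ![α₁, α₂, α₃])
    (F : Matrix (Fin 3) (Fin 3) ℂ) (hF : F = Matrix.diagonal ![2, 4, 2])
    (S : Matrix (Fin 3) (Fin 3) ℂ) (hS : S = Matrix.diagonal ![-1, 1, -1])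
    (σm : Matrix (Fin 3) (Fin 3) ℂ) (hσ : σm = !![0, 0, 1; 0, 1, 0; 1, 0, 0])
    (hE3 : wedgeTwo B * F⁻¹ = β • (A * B)) :
    Bᵀ * A * (S * B * σm * S * F) = (-16 * α₁ * α₂ * α₃ * β ^ 2) • (1 : Matrix (Fin 3) (Fin 3) ℂ) ∧
    (S * B * σm * S * F) * Bᵀ * A = (-16 * α₁ * α₂ * α₃ * β ^ 2) • (1 : Matrix (Fin 3) (Fin 3) ℂ) := by
  have hF_det : IsUnit F.det := by
    simp [hF, det_diagonal, Fin.prod_univ_three]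
  have hW : wedgeTwo B = β • (A * B * F) := by
    rw [← Matrix.smul_mul, ← hE3, nonsing_inv_mul_cancel_right _ _ hF_det]
  have hadj : B.adjugate = (β • (A * (S * B * σm * S * F)))ᵀ := by
    rw [adjugate_eq_transpose_wedgeTwo, hW, hA, hF, hS, hσ]
    ext i j
    fin_cases i <;> fin_cases j <;>
      simp [Matrix.mul_apply, Fin.sum_univ_three, diagonal_apply, -mul_eq_mul_left_iff] <;> ring
  have hdetX : (S * B * σm * S * F).det = -16 * B.det := by
    simp only [det_mul, hS, hF, hσ, det_diagonal, Fin.prod_univ_three, det_fin_three]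
    simp
    ring
  have hdetA : A.det = α₁ * α₂ * α₃ := by
    simp [hA, det_diagonal, Fin.prod_univ_three]
  generalize S * B * σm * S * F = X at hadj hdetX ⊢
  have hkey : β • (Bᵀ * A * X) = B.det • (1 : Matrix (Fin 3) (Fin 3) ℂ) := by
    have h := congrArg transpose (adjugate_mul B)
    rw [hadj, transpose_mul, transpose_transpose, transpose_smul, transpose_one, Matrix.mul_smul] at h
    rw [Matrix.mul_assoc, h]
  have hdet : B.det = -16 * α₁ * α₂ * α₃ * β ^ 3 := by
    have h := congrArg det hkey
    simp only [det_smul, det_mul, det_transpose, det_one, hdetX, hdetA, Fintype.card_fin] at h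
    apply mul_left_cancel₀ (pow_ne_zero 2 hB)
    linear_combination -h
  have hβ : β ≠ 0 := by
    rintro rfl
    simp [hdet] at hB
  have hc : -16 * α₁ * α₂ * α₃ * β ^ 2 ≠ 0 := by
    intro h
    exact hB (by linear_combination hdet + β * h)
  have hE1 : Bᵀ * A * X = (-16 * α₁ * α₂ * α₃ * β ^ 2) • (1 : Matrix (Fin 3) (Fin 3) ℂ) := by
    apply smul_right_injective _ hβ
    change β • _ = β • _
    rw [hkey, hdet, smul_smul]
    congr 1
    ring
  refine ⟨hE1, ?_⟩
  generalize -16 * α₁ * α₂ * α₃ * β ^ 2 = c at hc hE1 ⊢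
  have h : (c⁻¹ • (Bᵀ * A)) * X = 1 := by
    rw [Matrix.smul_mul, hE1, smul_smul, inv_mul_cancel₀ hc, one_smul]
  rw [mul_eq_one_comm, Matrix.mul_smul] at h
  rw [Matrix.mul_assoc, ← h, smul_smul, mul_inv_cancel₀ hc, one_smul]
end

section
/- Let n ≥ 4 be an even natural number, let ε = exp(π·I/(n−2)) ∈ ℂ, and let τ_a and τ_x be the ℂ-algebra endomorphisms of ℂ[X,Y] determined by τ_a: X ↦ ε·X, Y ↦ ε⁻¹·Y and τ_x: X ↦ I·Y, Y ↦ I·X. Set A' = X²·Y², B' = X^{2(n−2)} + Y^{2(n−2)} and C' = X^{2(n−2)+1}·Y − X·Y^{2(n−2)+1}. Then τ_a(A') = A', τ_a(B') = B', τ_a(C') = C', τ_x(A') = A', τ_x(B') = B', τ_x(C') = C', and the three polynomials satisfy the Kleinian D_n relation C'² = A'·B'² − 4·A'^{n−1}. -/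
open MvPolynomial

/-- For even `n ≥ 4` and `ε = exp(πI/(n−2))`, the polynomials
`A' = X²Y²`, `B' = X^{2(n−2)} + Y^{2(n−2)}`, `C' = X^{2(n−2)+1}Y − XY^{2(n−2)+1}`
are invariant under the binary dihedral substitutions `τ_a : X ↦ εX, Y ↦ ε⁻¹Y` and
`τ_x : X ↦ IY, Y ↦ IX`, and satisfy the Kleinian D_n relation
`C'² = A'·B'² − 4·A'^{n−1}`. -/
theorem stmt_13 (n : ℕ) (hn : 4 ≤ n) (heven : Even n)
    (ε : ℂ) (hε : ε = Complex.exp ((Real.pi : ℂ) * Complex.I / ((n : ℂ) - 2)))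
    (τa τx : MvPolynomial (Fin 2) ℂ →ₐ[ℂ] MvPolynomial (Fin 2) ℂ)
    (hτa : τa = aeval (fun i : Fin 2 =>
      if i = 0 then ε • (X 0 : MvPolynomial (Fin 2) ℂ) else ε⁻¹ • X 1))
    (hτx : τx = aeval (fun i : Fin 2 =>
      if i = 0 then Complex.I • (X 1 : MvPolynomial (Fin 2) ℂ) else Complex.I • X 0))
    (A' B' C' : MvPolynomial (Fin 2) ℂ)
    (hA' : A' = X 0 ^ 2 * X 1 ^ 2)
    (hB' : B' = X 0 ^ (2 * (n - 2)) + X 1 ^ (2 * (n - 2)))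
    (hC' : C' = X 0 ^ (2 * (n - 2) + 1) * X 1 - X 0 * X 1 ^ (2 * (n - 2) + 1)) :
    τa A' = A' ∧ τa B' = B' ∧ τa C' = C' ∧
    τx A' = A' ∧ τx B' = B' ∧ τx C' = C' ∧
    C' ^ 2 = A' * B' ^ 2 - 4 * A' ^ (n - 1) := by
  obtain ⟨m, rfl⟩ : ∃ m, n = m + 2 := ⟨n - 2, by omega⟩
  have hm : Even m := by simpa [Nat.even_add] using heven
  have hm0 : (m : ℂ) ≠ 0 := by
    have : m ≠ 0 := by omega
    exact_mod_cast this
  have hε0 : ε ≠ 0 := hε ▸ Complex.exp_ne_zero _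
  have hεpow : ε ^ (2 * m) = 1 := by
    rw [hε, ← Complex.exp_nat_mul, ← Complex.exp_two_pi_mul_I]
    congr 1
    push_cast
    rw [add_sub_cancel_right]
    field_simp
  have hIpow : Complex.I ^ (2 * m) = 1 := by
    rw [pow_mul, Complex.I_sq, hm.neg_one_pow]
  have hc : (C ε : MvPolynomial (Fin 2) ℂ) ^ (2 * m) = 1 := by
    rw [← C_pow, hεpow, C_1]
  have hd : (C ε⁻¹ : MvPolynomial (Fin 2) ℂ) ^ (2 * m) = 1 := by
    rw [← C_pow, inv_pow, hεpow, inv_one, C_1]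
  have hcd : (C ε : MvPolynomial (Fin 2) ℂ) * C ε⁻¹ = 1 := by
    rw [← C_mul, mul_inv_cancel₀ hε0, C_1]
  have hI : (C Complex.I : MvPolynomial (Fin 2) ℂ) ^ (2 * m) = 1 := by
    rw [← C_pow, hIpow, C_1]
  have hI2 : (C Complex.I : MvPolynomial (Fin 2) ℂ) ^ 2 = -1 := by
    rw [← C_pow, Complex.I_sq, C_neg, C_1]
  have ha0 : τa (X 0) = C ε * X 0 := by simp [hτa, smul_eq_C_mul]
  have ha1 : τa (X 1) = C ε⁻¹ * X 1 := by simp [hτa, smul_eq_C_mul]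
  have hx0 : τx (X 0) = C Complex.I * X 1 := by simp [hτx, smul_eq_C_mul]
  have hx1 : τx (X 1) = C Complex.I * X 0 := by simp [hτx, smul_eq_C_mul]
  clear hτa hτx
  rw [Nat.add_sub_cancel] at hB' hC'
  rw [show m + 2 - 1 = m + 1 from rfl]
  subst hA' hB' hC'
  simp only [map_add, map_sub, map_mul, map_pow, ha0, ha1, hx0, hx1, mul_pow, pow_succ _ (2 * m),
    hc, hd, hI, one_mul]
  generalize (C ε : MvPolynomial (Fin 2) ℂ) = c at *
  generalize (C ε⁻¹ : MvPolynomial (Fin 2) ℂ) = d at *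
  generalize (C Complex.I : MvPolynomial (Fin 2) ℂ) = j at *
  generalize (X 0 : MvPolynomial (Fin 2) ℂ) = x at *
  generalize (X 1 : MvPolynomial (Fin 2) ℂ) = y at *
  refine ⟨?_, trivial, ?_, ?_, add_comm _ _, ?_, ?_⟩
  · linear_combination (x ^ 2 * y ^ 2 * (c * d + 1)) * hcd
  · linear_combination (x ^ (2 * m) * x * y - x * (y ^ (2 * m) * y)) * hcd
  · linear_combination (x ^ 2 * y ^ 2 * (j ^ 2 - 1)) * hI2
  · linear_combination (y ^ (2 * m) * y * x - y * (x ^ (2 * m) * x)) * hI2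
  · ring
end

section
/- Let n ≥ 4 be an even natural number, let ε = exp(π·I/(n−2)) ∈ ℂ, and let τ_a and τ_x be the ℂ-algebra endomorphisms of ℂ[X,Y] determined by τ_a: X ↦ ε·X, Y ↦ ε⁻¹·Y and τ_x: X ↦ I·Y, Y ↦ I·X. Then the set of polynomials p ∈ ℂ[X,Y] with τ_a(p) = p and τ_x(p) = p is exactly the ℂ-subalgebra of ℂ[X,Y] generated by the three elements A' = X²·Y², B' = X^{2(n−2)} + Y^{2(n−2)} and C' = X^{2(n−2)+1}·Y − X·Y^{2(n−2)+1}. -/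
open MvPolynomial

/-- Scaling the variables by `r` and `s` multiplies the coefficient of `X ^ a * Y ^ b`
by `r ^ a * s ^ b`. -/
lemma coeff_aeval_scale {R : Type*} [CommSemiring R] (r s : R) (p : MvPolynomial (Fin 2) R)
    (d : Fin 2 →₀ ℕ) :
    coeff d (aeval (fun i : Fin 2 =>
      if i = 0 then r • (X 0 : MvPolynomial (Fin 2) R) else s • X 1) p) =
      r ^ d 0 * s ^ d 1 * coeff d p := by
  classical
  induction p using MvPolynomial.induction_on' with
  | monomial u c =>
    have h : aeval (fun i : Fin 2 =>
        if i = 0 then r • (X 0 : MvPolynomial (Fin 2) R) else s • X 1) (monomial u c) =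
        (r ^ u 0 * s ^ u 1) • monomial u c := by
      rw [aeval_monomial, monomial_eq, Finsupp.prod_fintype _ _ (by simp),
        Finsupp.prod_fintype _ _ (by simp)]
      simp only [Fin.prod_univ_two, if_true, one_ne_zero, if_false, smul_eq_C_mul, mul_pow,
        algebraMap_eq, map_mul, map_pow]
      ring
    rw [h, coeff_smul, coeff_monomial]
    split_ifs with hu
    · rw [hu, smul_eq_mul]
    · simp
  | add p q hp hq => rw [map_add, coeff_add, coeff_add, hp, hq, mul_add]

/-- The sums `c * u ^ k + d * v ^ k` satisfy the recurrence with characteristic roots `u` and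
`v`, so they lie in a subalgebra as soon as `u + v`, `u * v` and the first two of them do. -/
lemma Subalgebra.mul_pow_add_mul_pow_mem {R A : Type*} [CommRing R] [CommRing A] [Algebra R A]
    (S : Subalgebra R A) {u v c d : A} (hadd : u + v ∈ S) (hmul : u * v ∈ S)
    (h₀ : c + d ∈ S) (h₁ : c * u + d * v ∈ S) (k : ℕ) : c * u ^ k + d * v ^ k ∈ S := by
  induction k using Nat.twoStepInduction with
  | zero => simpa using h₀
  | one => simpa using h₁
  | more k ih ih' =>
    have h : c * u ^ (k + 2) + d * v ^ (k + 2) =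
        (u + v) * (c * u ^ (k + 1) + d * v ^ (k + 1)) - u * v * (c * u ^ k + d * v ^ k) := by
      ring
    rw [h]
    exact S.sub_mem (S.mul_mem hadd ih') (S.mul_mem hmul ih)

/-- A subalgebra containing the three dihedral invariants contains the symmetrization of every
monomial `x ^ (b + 2 * m * k) * y ^ b`. -/
lemma Subalgebra.symmetrized_monomial_mem {R A : Type*} [CommRing R] [CommRing A] [Algebra R A]
    (S : Subalgebra R A) {x y : A} {m : ℕ} (hA : x ^ 2 * y ^ 2 ∈ S)
    (hB : x ^ (2 * m) + y ^ (2 * m) ∈ S)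
    (hC : x ^ (2 * m + 1) * y - x * y ^ (2 * m + 1) ∈ S) (b k : ℕ) :
    x ^ (b + 2 * m * k) * y ^ b + (-1) ^ b * (x ^ b * y ^ (b + 2 * m * k)) ∈ S := by
  have hmul : x ^ (2 * m) * y ^ (2 * m) ∈ S := by
    rw [pow_mul, pow_mul, ← mul_pow]
    exact S.pow_mem hA m
  rcases Nat.even_or_odd' b with ⟨c, rfl | rfl⟩
  · have h := S.mul_pow_add_mul_pow_mem (c := 1) (d := 1) hB hmul
      (S.add_mem S.one_mem S.one_mem) (by simpa using hB) k
    have e : x ^ (2 * c + 2 * m * k) * y ^ (2 * c) +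
        (-1) ^ (2 * c) * (x ^ (2 * c) * y ^ (2 * c + 2 * m * k)) =
        (x ^ 2 * y ^ 2) ^ c * (1 * (x ^ (2 * m)) ^ k + 1 * (y ^ (2 * m)) ^ k) := by
      rw [pow_mul (-1 : A), neg_one_sq, one_pow]
      ring
    rw [e]
    exact S.mul_mem (S.pow_mem hA c) h
  · have h := S.mul_pow_add_mul_pow_mem (c := x * y) (d := -(x * y)) hB hmul
      (by simp) (by convert hC using 1; ring) k
    have e : x ^ (2 * c + 1 + 2 * m * k) * y ^ (2 * c + 1) +
        (-1) ^ (2 * c + 1) * (x ^ (2 * c + 1) * y ^ (2 * c + 1 + 2 * m * k)) =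
        (x ^ 2 * y ^ 2) ^ c *
          (x * y * (x ^ (2 * m)) ^ k + -(x * y) * (y ^ (2 * m)) ^ k) := by
      rw [pow_succ (-1 : A), pow_mul (-1 : A), neg_one_sq, one_pow]
      ring
    rw [e]
    exact S.mul_mem (S.pow_mem hA c) h

/-- For even `n ≥ 4`, the polynomials fixed by both binary dihedral
substitutions `τ_a : X ↦ εX, Y ↦ ε⁻¹Y` (with `ε = exp(πI/(n−2))`) and
`τ_x : X ↦ IY, Y ↦ IX` are exactly the subalgebra generated by `A' = X²Y²`,
`B' = X^{2(n−2)} + Y^{2(n−2)}` and `C' = X^{2(n−2)+1}Y − XY^{2(n−2)+1}`. -/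
theorem stmt_14 (n : ℕ) (hn : 4 ≤ n) (heven : Even n)
    (ε : ℂ) (hε : ε = Complex.exp ((Real.pi : ℂ) * Complex.I / ((n : ℂ) - 2)))
    (τa τx : MvPolynomial (Fin 2) ℂ →ₐ[ℂ] MvPolynomial (Fin 2) ℂ)
    (hτa : τa = aeval (fun i : Fin 2 =>
      if i = 0 then ε • (X 0 : MvPolynomial (Fin 2) ℂ) else ε⁻¹ • X 1))
    (hτx : τx = aeval (fun i : Fin 2 =>
      if i = 0 then Complex.I • (X 1 : MvPolynomial (Fin 2) ℂ) else Complex.I • X 0)) :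
    {p : MvPolynomial (Fin 2) ℂ | τa p = p ∧ τx p = p} =
      (Algebra.adjoin ℂ
        {(X 0 : MvPolynomial (Fin 2) ℂ) ^ 2 * X 1 ^ 2,
         (X 0 : MvPolynomial (Fin 2) ℂ) ^ (2 * (n - 2)) + X 1 ^ (2 * (n - 2)),
         (X 0 : MvPolynomial (Fin 2) ℂ) ^ (2 * (n - 2) + 1) * X 1
           - X 0 * X 1 ^ (2 * (n - 2) + 1)} :
        Subalgebra ℂ (MvPolynomial (Fin 2) ℂ)) := by
  obtain ⟨m, rfl⟩ : ∃ m, n = m + 2 := ⟨n - 2, by omega⟩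
  obtain ⟨l, rfl⟩ : ∃ l, m = 2 * l := by
    obtain ⟨j, hj⟩ := heven
    exact ⟨j - 1, by omega⟩
  simp only [Nat.add_sub_cancel]
  have hprim : IsPrimitiveRoot ε (2 * (2 * l)) := by
    have h := Complex.isPrimitiveRoot_exp (2 * (2 * l)) (by omega)
    rw [hε]
    convert h using 2
    have hl : (l : ℂ) ≠ 0 := by
      norm_cast
      omega
    push_cast
    rw [add_sub_cancel_right]
    field_simp
  have hε0 : ε ≠ 0 := hprim.ne_zero (by omega)
  have haX : τa (X 0) = C ε * X 0 := by simp [hτa, smul_eq_C_mul]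
  have haY : τa (X 1) = C ε⁻¹ * X 1 := by simp [hτa, smul_eq_C_mul]
  have hxX : τx (X 0) = C Complex.I * X 1 := by simp [hτx, smul_eq_C_mul]
  have hxY : τx (X 1) = C Complex.I * X 0 := by simp [hτx, smul_eq_C_mul]
  have hCε : (C ε * C ε⁻¹ : MvPolynomial (Fin 2) ℂ) = 1 := by
    rw [← C_mul, mul_inv_cancel₀ hε0, C_1]
  have hCε₁ : (C ε : MvPolynomial (Fin 2) ℂ) ^ (2 * (2 * l)) = 1 := by
    rw [← C_pow, hprim.pow_eq_one, C_1]
  have hCε₂ : (C ε⁻¹ : MvPolynomial (Fin 2) ℂ) ^ (2 * (2 * l)) = 1 := by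
    rw [← C_pow, inv_pow, hprim.pow_eq_one, inv_one, C_1]
  have hI : (C Complex.I : MvPolynomial (Fin 2) ℂ) ^ 2 = -1 := by
    rw [← C_pow, Complex.I_sq, C_neg, C_1]
  have hI4 : (C Complex.I : MvPolynomial (Fin 2) ℂ) ^ (2 * (2 * l)) = 1 := by
    rw [pow_mul, hI, pow_mul, neg_one_sq, one_pow]
  have hIpow : ∀ b k : ℕ, (C Complex.I : MvPolynomial (Fin 2) ℂ) ^ b *
      C Complex.I ^ (b + 2 * (2 * l) * k) = (-1) ^ b := fun b k => by
    rw [pow_add, pow_mul _ (2 * (2 * l)), hI4, one_pow, mul_one, ← mul_pow, ← sq, hI]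
  apply Set.Subset.antisymm
  · rintro p ⟨hpa, hpx⟩
    set S := Algebra.adjoin ℂ
        {(X 0 : MvPolynomial (Fin 2) ℂ) ^ 2 * X 1 ^ 2,
         (X 0 : MvPolynomial (Fin 2) ℂ) ^ (2 * (2 * l)) + X 1 ^ (2 * (2 * l)),
         (X 0 : MvPolynomial (Fin 2) ℂ) ^ (2 * (2 * l) + 1) * X 1
           - X 0 * X 1 ^ (2 * (2 * l) + 1)}
    have hsymm := S.symmetrized_monomial_mem (x := X 0) (y := X 1) (m := 2 * l)
      (Algebra.subset_adjoin (by simp)) (Algebra.subset_adjoin (by simp))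
      (Algebra.subset_adjoin (by simp))
    have hmono : ∀ d ∈ p.support, monomial d (coeff d p) + τx (monomial d (coeff d p)) ∈ S := by
      intro d hd
      have hcoeff := coeff_aeval_scale ε ε⁻¹ p d
      rw [← hτa, hpa] at hcoeff
      have hchar : ε ^ d 0 * ε⁻¹ ^ d 1 = 1 :=
        mul_right_cancel₀ (mem_support_iff.mp hd) (by rw [← hcoeff, one_mul])
      have hdvd : ((2 * (2 * l) : ℕ) : ℤ) ∣ (d 0 : ℤ) - d 1 := by
        rw [← hprim.zpow_eq_one_iff_dvd, zpow_sub₀ hε0, zpow_natCast, zpow_natCast,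
          div_eq_mul_inv, ← inv_pow, hchar]
      have hd' : monomial d (coeff d p) = coeff d p • (X 0 ^ d 0 * X 1 ^ d 1) := by
        rw [monomial_eq, Finsupp.prod_fintype _ _ (by simp), Fin.prod_univ_two, smul_eq_C_mul]
      rw [hd', map_smul, ← smul_add]
      refine S.smul_mem ?_ _
      rw [map_mul, map_pow, map_pow, hxX, hxY]
      rcases le_total (d 1) (d 0) with hle | hle
      · obtain ⟨k, hk⟩ : 2 * (2 * l) ∣ d 0 - d 1 := by
          rw [← Int.natCast_dvd_natCast, Nat.cast_sub hle]
          exact hdvd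
        have h0 : d 0 = d 1 + 2 * (2 * l) * k := by omega
        rw [h0]
        convert hsymm (d 1) k using 2
        rw [mul_pow, mul_pow]
        linear_combination (X 0 ^ d 1 * X 1 ^ (d 1 + 2 * (2 * l) * k)) * hIpow (d 1) k
      · obtain ⟨k, hk⟩ : 2 * (2 * l) ∣ d 1 - d 0 := by
          rw [← Int.natCast_dvd_natCast, Nat.cast_sub hle, ← neg_sub, dvd_neg]
          exact hdvd
        have h1 : d 1 = d 0 + 2 * (2 * l) * k := by omega
        rw [h1]
        have hsq : ((-1 : MvPolynomial (Fin 2) ℂ) ^ d 0) * (-1) ^ d 0 = 1 := by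
          rw [← mul_pow]
          simp
        convert S.mul_mem (S.pow_mem (S.neg_mem S.one_mem) (d 0)) (hsymm (d 0) k) using 1
        rw [mul_pow, mul_pow]
        linear_combination (X 1 ^ d 0 * X 0 ^ (d 0 + 2 * (2 * l) * k)) * hIpow (d 0) k -
          (X 0 ^ d 0 * X 1 ^ (d 0 + 2 * (2 * l) * k)) * hsq
    have hsum : p + τx p ∈ S := by
      have h := S.sum_mem hmono
      rwa [Finset.sum_add_distrib, ← map_sum, ← p.as_sum] at h
    rw [hpx] at hsum
    have hhalf : p = (2⁻¹ : ℂ) • (p + p) := by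
      rw [← two_smul ℂ p, smul_smul, inv_mul_cancel₀ two_ne_zero, one_smul]
    rw [SetLike.mem_coe, hhalf]
    exact S.smul_mem hsum _
  · have hle : Algebra.adjoin ℂ
        {(X 0 : MvPolynomial (Fin 2) ℂ) ^ 2 * X 1 ^ 2,
         (X 0 : MvPolynomial (Fin 2) ℂ) ^ (2 * (2 * l)) + X 1 ^ (2 * (2 * l)),
         (X 0 : MvPolynomial (Fin 2) ℂ) ^ (2 * (2 * l) + 1) * X 1
           - X 0 * X 1 ^ (2 * (2 * l) + 1)} ≤
        AlgHom.equalizer τa (AlgHom.id ℂ _) ⊓ AlgHom.equalizer τx (AlgHom.id ℂ _) := by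
      rw [Algebra.adjoin_le_iff]
      rintro q (rfl | rfl | rfl)
      · refine ⟨?_, ?_⟩ <;>
          simp only [SetLike.mem_coe, AlgHom.mem_equalizer, AlgHom.id_apply, map_mul, map_pow,
            haX, haY, hxX, hxY]
        · linear_combination (X 0 ^ 2 * X 1 ^ 2) * (C ε * C ε⁻¹ + 1) * hCε
        · linear_combination (X 0 ^ 2 * X 1 ^ 2) * (C Complex.I ^ 2 - 1) * hI
      · refine ⟨?_, ?_⟩ <;>
          simp only [SetLike.mem_coe, AlgHom.mem_equalizer, AlgHom.id_apply, map_add, map_pow,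
            haX, haY, hxX, hxY, mul_pow, hCε₁, hCε₂, hI4, one_mul]
        exact add_comm _ _
      · refine ⟨?_, ?_⟩ <;>
          simp only [SetLike.mem_coe, AlgHom.mem_equalizer, AlgHom.id_apply, map_sub, map_mul,
            map_pow, haX, haY, hxX, hxY, mul_pow, pow_succ _ (2 * (2 * l)), hCε₁, hCε₂, hI4,
            one_mul]
        · linear_combination (X 0 ^ (2 * (2 * l)) * X 0 * X 1 -
            X 0 * (X 1 ^ (2 * (2 * l)) * X 1)) * hCε
        · linear_combination (X 1 ^ (2 * (2 * l)) * X 1 * X 0 -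
            X 1 * (X 0 ^ (2 * (2 * l)) * X 0)) * hI
    intro p hp
    exact hle hp
end

section
/- Let n ≥ 3 be a natural number and consider the matrices a = diag(exp(π·I/(n−2)), exp(−π·I/(n−2))) and x = [[0, I],[I, 0]] in GL₂(ℂ). Then a^{2(n−2)} = 1, x² = a^{n−2}, x⁻¹·a·x = a⁻¹, both matrices have determinant 1, and the subgroup of GL₂(ℂ) generated by a and x has exactly 4(n−2) elements. -/
open Matrix

/-- If `x` inverts `a` by conjugation, `x ^ 2` is a power of `a` and `x` is not, then the subgroup
generated by `a` and `x` contains `zpowers a` with index two. -/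
theorem Subgroup.card_closure_pair_of_conj_eq_inv {G : Type*} [Group G] {a x : G}
    (hconj : x⁻¹ * a * x = a⁻¹) (hsq : x ^ 2 ∈ zpowers a) (hx : x ∉ zpowers a) :
    Nat.card (closure {a, x}) = 2 * orderOf a := by
  have hle : zpowers a ≤ closure {a, x} := by
    rw [zpowers_le]
    exact subset_closure (by simp)
  have ha : a ∈ zpowers a := mem_zpowers a
  have hax : a * x = x * a⁻¹ := by rw [← hconj]; group
  have hax' : a⁻¹ * x = x * a := by
    rw [inv_mul_eq_iff_eq_mul, ← mul_assoc, hax, inv_mul_cancel_right]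
  have key : ∀ b ∈ closure {a, x}, b ∈ zpowers a ∨ b * x ∈ zpowers a := by
    intro b hb
    induction hb using closure_induction_right with
    | one => exact Or.inl (one_mem _)
    | mul_right b hb y hy ih =>
      rcases hy with rfl | rfl
      · refine ih.imp (fun h => mul_mem h ha) fun h => ?_
        rw [mul_assoc, hax, ← mul_assoc]
        exact mul_mem h (inv_mem ha)
      · refine ih.symm.imp id fun h => ?_
        rw [mul_assoc, ← sq]
        exact mul_mem h hsq
    | mul_inv_cancel b hb y hy ih =>
      rcases hy with rfl | rfl
      · refine ih.imp (fun h => mul_mem h (inv_mem ha)) fun h => ?_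
        rw [mul_assoc, hax', ← mul_assoc]
        exact mul_mem h ha
      · refine ih.symm.imp (fun h => ?_) fun h => by simpa using h
        have := mul_mem h (inv_mem hsq)
        rwa [sq, _root_.mul_inv_rev, mul_assoc, mul_inv_cancel_left] at this
  have hindex : (zpowers a).relIndex (closure {a, x}) = 2 := by
    rw [relIndex, index_eq_two_iff]
    refine ⟨⟨x, subset_closure (by simp)⟩, fun b => ?_⟩
    simp only [mem_subgroupOf, coe_mul]
    rcases key b b.2 with h | h
    · exact Or.inr ⟨h, fun h' => hx ((mul_mem_cancel_left h).1 h')⟩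
    · exact Or.inl ⟨h, fun h' => hx ((mul_mem_cancel_left h').1 h)⟩
  have hcard := card_mul_index ((zpowers a).subgroupOf (closure {a, x}))
  rw [← relIndex, hindex, Nat.card_congr (subgroupOfEquivOfLe hle).toEquiv,
    Nat.card_zpowers] at hcard
  rw [← hcard, mul_comm]

/-- The matrices `a = diag(exp(πI/(n−2)), exp(−πI/(n−2)))` and
`x = [[0,I],[I,0]]` in `GL₂(ℂ)` satisfy the binary dihedral relations
`a^{2(n−2)} = 1`, `x² = a^{n−2}`, `x⁻¹ a x = a⁻¹`, have determinant `1`, and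
generate a subgroup of order `4(n−2)` (the Kleinian group `BD_{n−2}` of type `D_n`). -/
theorem stmt_16 (n : ℕ) (hn : 3 ≤ n)
    (a x : GL (Fin 2) ℂ)
    (ha : (a : Matrix (Fin 2) (Fin 2) ℂ) =
      !![Complex.exp ((Real.pi : ℂ) * Complex.I / ((n : ℂ) - 2)), 0;
         0, Complex.exp (-((Real.pi : ℂ) * Complex.I) / ((n : ℂ) - 2))])
    (hx : (x : Matrix (Fin 2) (Fin 2) ℂ) = !![0, Complex.I; Complex.I, 0]) :
    a ^ (2 * (n - 2)) = 1 ∧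
    x ^ 2 = a ^ (n - 2) ∧
    x⁻¹ * a * x = a⁻¹ ∧
    (a : Matrix (Fin 2) (Fin 2) ℂ).det = 1 ∧
    (x : Matrix (Fin 2) (Fin 2) ℂ).det = 1 ∧
    Nat.card (Subgroup.closure {a, x} : Subgroup (GL (Fin 2) ℂ)) = 4 * (n - 2) := by
  obtain ⟨m, rfl⟩ : ∃ m, n = m + 2 := ⟨n - 2, by omega⟩
  have hm : m ≠ 0 := by omega
  have hmC : (m : ℂ) ≠ 0 := Nat.cast_ne_zero.2 hm
  simp only [Nat.add_sub_cancel]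
  push_cast at ha
  rw [add_sub_cancel_right, neg_div, Complex.exp_neg] at ha
  obtain ⟨ζ, hζ⟩ : ∃ ζ, ζ = Complex.exp ((Real.pi : ℂ) * Complex.I / m) := ⟨_, rfl⟩
  rw [← hζ] at ha
  have hζ0 : ζ ≠ 0 := hζ ▸ Complex.exp_ne_zero _
  have hζm : ζ ^ m = -1 := by
    rw [hζ, ← Complex.exp_nat_mul, mul_div_cancel₀ _ hmC, Complex.exp_pi_mul_I]
  have hprim : IsPrimitiveRoot ζ (2 * m) := by
    convert Complex.isPrimitiveRoot_exp (2 * m) (by omega) using 1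
    rw [hζ]
    congr 1
    push_cast
    field_simp
  have hpow (k : ℕ) : ((a ^ k : GL (Fin 2) ℂ) : Matrix (Fin 2) (Fin 2) ℂ) =
      !![ζ ^ k, 0; 0, (ζ ^ k)⁻¹] := by
    induction k with
    | zero => simp [Matrix.one_fin_two]
    | succ k ih => rw [pow_succ, Units.val_mul, ih, ha]; simp [pow_succ, mul_comm]
  have hone : a ^ (2 * m) = 1 := by
    ext1
    rw [hpow, hprim.pow_eq_one]
    simp [Matrix.one_fin_two]
  have hsq : x ^ 2 = a ^ m := by
    ext1
    rw [hpow, hζm, Units.val_pow_eq_pow_val, hx, sq]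
    simp
  have hconj : x⁻¹ * a * x = a⁻¹ := by
    rw [eq_inv_iff_mul_eq_one, mul_assoc, mul_assoc, inv_mul_eq_one]
    ext1
    simp only [Units.val_mul, ha, hx]
    simp [mul_left_comm _ Complex.I, hζ0]
  have horder : orderOf a = 2 * m := by
    refine Nat.dvd_antisymm (orderOf_dvd_of_pow_eq_one hone) (hprim.dvd_of_pow_eq_one _ ?_)
    have h := hpow (orderOf a)
    rw [pow_orderOf_eq_one] at h
    simpa using (congr_fun₂ h 0 0).symm
  have hxa : x ∉ Subgroup.zpowers a := by
    have hfin : IsOfFinOrder a := isOfFinOrder_iff_pow_eq_one.2 ⟨2 * m, by omega, hone⟩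
    rw [← hfin.mem_powers_iff_mem_zpowers]
    rintro ⟨k, rfl⟩
    have h := congr_fun₂ ((hpow k).symm.trans hx) 0 1
    simp [Complex.I_ne_zero.symm] at h
  refine ⟨hone, hsq, hconj, ?_, ?_, ?_⟩
  · simp [ha, Matrix.det_fin_two, hζ0]
  · simp [hx, Matrix.det_fin_two]
  · rw [Subgroup.card_closure_pair_of_conj_eq_inv hconj (hsq ▸ Subgroup.npow_mem_zpowers a m) hxa,
      horder]
    ring
end

section
/- Let n, p, q, k, k₀, l, l₀ be natural numbers with p ≥ 1 and 1 ≤ q ≤ n−1. If q·p·k + (n−q)·(p+1)·l = q·p·k₀ + (n−q)·(p+1)·l₀ and (n−q)·|(l₀ : ℤ) − (l : ℤ)| < p, then l = l₀ and k = k₀. -/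
/-- Cancellation lemma (coprimality of `p` and `p+1`): if
`qpk + (n−q)(p+1)l = qpk₀ + (n−q)(p+1)l₀` and `(n−q)·|l₀ − l| < p`, then
`l = l₀` and `k = k₀`. -/
theorem stmt_17 (n p q k k₀ l l₀ : ℕ) (hp : 1 ≤ p) (hq1 : 1 ≤ q) (hq2 : q ≤ n - 1)
    (heq : q * p * k + (n - q) * (p + 1) * l = q * p * k₀ + (n - q) * (p + 1) * l₀)
    (habs : ((n - q : ℕ) : ℤ) * |(l₀ : ℤ) - (l : ℤ)| < (p : ℤ)) :
    l = l₀ ∧ k = k₀ := by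
  have hm : 0 < n - q := by omega
  generalize n - q = m at heq habs hm
  have hdvd : (p : ℤ) ∣ m * ((l₀ : ℤ) - l) := by
    refine ⟨q * ((k : ℤ) - k₀) - m * ((l₀ : ℤ) - l), ?_⟩
    zify at heq
    linear_combination -heq
  have hzero : (m : ℤ) * ((l₀ : ℤ) - l) = 0 := by
    refine Int.eq_zero_of_abs_lt_dvd hdvd ?_
    rwa [abs_mul, Nat.abs_cast]
  have hl : l = l₀ := by
    rcases mul_eq_zero.mp hzero with h | h <;> omega
  subst hl
  exact ⟨rfl, Nat.eq_of_mul_eq_mul_left (Nat.mul_pos hq1 hp) (Nat.add_right_cancel heq)⟩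
end

section
/- Let n ≥ 3 be an odd natural number, let m₀, l₀, p be natural numbers with p ≥ 1, set q = (n−1)/2 − m₀ and assume q ≥ 1 and l₀ < q(q+1)/2, and set k₀ = l₀ + (n+1)/2 + m₀·(n+1). Define α : {1,…,n} → ℤ by α(j) = −j·q·p for 1 ≤ j ≤ n−q and α(j) = −(n+1−j)·(n−q)·(p+1) for n−q+1 ≤ j ≤ n. Then ∑_{j=1}^{n} α(j) = −(n−q)(n−q+1)·q·p/2 − q(q+1)·(n−q)·(p+1)/2, and ∑_{j=1}^{n} α(j) + q·p·k₀ + (n−q)·(p+1)·l₀ < 0. -/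
open Finset

/-- Twice the sum of the first `k` positive integers, in `ℤ`. -/
theorem two_mul_sum_range_succ (k : ℕ) :
    2 * ∑ i ∈ range k, ((i : ℤ) + 1) = k * (k + 1) := by
  induction k with
  | zero => simp
  | succ k ih =>
    rw [sum_range_succ, mul_add, ih]
    push_cast
    ring

/-- Twice the sum of a decreasing run of `k` consecutive integers starting at `a`. -/
theorem two_mul_sum_range_sub (a : ℤ) (k : ℕ) :
    2 * ∑ i ∈ range k, (a - i) = k * (2 * a - k + 1) := by
  induction k with
  | zero => simp
  | succ k ih =>
    rw [sum_range_succ, mul_add, ih]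
    push_cast
    ring

/-- Twice the sum of a function on `{1, …, r + q}` that is linear with slope `c` through `0` on
`{1, …, r}` and linear with slope `-d` vanishing at `r + q + 1` on the remaining points. -/
theorem two_mul_sum_Icc_piecewise (r q : ℕ) (c d : ℤ) (f : ℕ → ℤ)
    (h₁ : ∀ j : ℕ, 1 ≤ j → j ≤ r → f j = j * c)
    (h₂ : ∀ j : ℕ, r + 1 ≤ j → j ≤ r + q → f j = ((r : ℤ) + q + 1 - j) * d) :
    2 * ∑ j ∈ Icc 1 (r + q), f j = r * (r + 1) * c + q * (q + 1) * d := by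
  have hshift : ∑ j ∈ Icc 1 (r + q), f j = ∑ i ∈ range (r + q), f (i + 1) := by
    rw [range_eq_Ico, sum_Ico_add' f 0 (r + q) 1]
    rfl
  have hleft : ∑ i ∈ range r, f (i + 1) = (∑ i ∈ range r, ((i : ℤ) + 1)) * c := by
    rw [sum_mul]
    refine sum_congr rfl fun i hi => ?_
    have := mem_range.mp hi
    rw [h₁ _ (by omega) (by omega)]
    push_cast
    ring
  have hright : ∑ i ∈ range q, f (r + i + 1) = (∑ i ∈ range q, ((q : ℤ) - i)) * d := by
    rw [sum_mul]
    refine sum_congr rfl fun i hi => ?_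
    have := mem_range.mp hi
    rw [h₂ _ (by omega) (by omega)]
    push_cast
    ring
  rw [hshift, sum_range_add, hleft, hright]
  linear_combination c * two_mul_sum_range_succ r + d * two_mul_sum_range_sub q q

/-- Negativity of the total `t`-exponent in the classification of
`θ₂`-semiinvariants on the A_n Clebsch–Gordan variety: with `q = (n−1)/2 − m₀ ≥ 1`,
`l₀ < q(q+1)/2`, `k₀ = l₀ + (n+1)/2 + m₀(n+1)`, and exponents
`α(j) = −jqp` for `1 ≤ j ≤ n−q` and `α(j) = −(n+1−j)(n−q)(p+1)` for `n−q+1 ≤ j ≤ n`,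
one has `∑_{j=1}^n α(j) = −(n−q)(n−q+1)qp/2 − q(q+1)(n−q)(p+1)/2` and
`∑_{j=1}^n α(j) + qpk₀ + (n−q)(p+1)l₀ < 0`. -/
theorem stmt_18 (n m₀ l₀ p : ℕ) (hn : 3 ≤ n) (hodd : Odd n) (hp : 1 ≤ p)
    (q : ℕ) (hq : q = (n - 1) / 2 - m₀) (hq1 : 1 ≤ q)
    (hl₀ : l₀ < q * (q + 1) / 2)
    (k₀ : ℕ) (hk₀ : k₀ = l₀ + (n + 1) / 2 + m₀ * (n + 1))
    (α : ℕ → ℤ)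
    (hα1 : ∀ j : ℕ, 1 ≤ j → j ≤ n - q → α j = -(j : ℤ) * (q : ℤ) * (p : ℤ))
    (hα2 : ∀ j : ℕ, n - q + 1 ≤ j → j ≤ n →
      α j = -((n : ℤ) + 1 - (j : ℤ)) * ((n : ℤ) - (q : ℤ)) * ((p : ℤ) + 1)) :
    (∑ j ∈ Finset.Icc 1 n, α j =
      -(((n : ℤ) - q) * ((n : ℤ) - q + 1) * q * p) / 2
      - ((q : ℤ) * ((q : ℤ) + 1) * ((n : ℤ) - q) * ((p : ℤ) + 1)) / 2) ∧
    (∑ j ∈ Finset.Icc 1 n, α j)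
      + (q : ℤ) * p * (k₀ : ℤ) + ((n : ℤ) - q) * ((p : ℤ) + 1) * (l₀ : ℤ) < 0 := by
  obtain ⟨h, rfl⟩ := hodd
  obtain ⟨r, hr⟩ : ∃ r, 2 * h + 1 = r + q := ⟨2 * h + 1 - q, by omega⟩
  have hm : r = q + 2 * m₀ + 1 := by omega
  have hrq : 2 * h + 1 - q = r := by omega
  have hcast : ((2 * h + 1 : ℕ) : ℤ) = r + q := by exact_mod_cast hr
  rw [hrq] at hα1 hα2
  rw [hcast] at hα2 ⊢
  rw [hr] at hα2 ⊢
  have hsum := two_mul_sum_Icc_piecewise r q (-(q * p)) (-(r * (p + 1))) α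
    (fun j h₁ h₂ => by rw [hα1 j h₁ h₂]; ring)
    (fun j h₁ h₂ => by rw [hα2 j h₁ h₂]; ring)
  obtain ⟨a, ha⟩ := (Int.even_mul_succ_self (r : ℤ)).two_dvd
  obtain ⟨b, hb⟩ := (Int.even_mul_succ_self (q : ℤ)).two_dvd
  have hS : ∑ j ∈ Icc 1 (r + q), α j = -(a * q * p) - b * r * (p + 1) := by
    refine mul_left_cancel₀ (two_ne_zero (α := ℤ)) ?_
    linear_combination hsum - q * p * ha - r * (p + 1) * hb
  have hl : (l₀ : ℤ) + 1 ≤ b := by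
    have : 2 * (l₀ + 1) ≤ q * (q + 1) := by omega
    zify at this
    linarith
  have hk : (k₀ : ℤ) = l₀ + a - b := by
    have hhalf : (2 * h + 1 + 1) / 2 = h + 1 := by omega
    rw [hhalf] at hk₀
    zify at hk₀ hm
    refine mul_left_cancel₀ (two_ne_zero (α := ℤ)) ?_
    have hh : (h : ℤ) = q + m₀ := by omega
    rw [hm] at ha
    rw [hk₀, hh]
    linear_combination ha - hb
  constructor
  · have h₁ : -(((r : ℤ) + q - q) * ((r : ℤ) + q - q + 1) * q * p) = 2 * -(a * q * p) := by
      linear_combination -(q * p : ℤ) * ha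
    have h₂ : (q : ℤ) * (q + 1) * ((r : ℤ) + q - q) * (p + 1) = 2 * (b * r * (p + 1)) := by
      linear_combination (r * (p + 1) : ℤ) * hb
    rw [h₁, h₂, Int.mul_ediv_cancel_left _ two_ne_zero, Int.mul_ediv_cancel_left _ two_ne_zero, hS]
  · have hfactor : -(a * q * p) - b * r * (p + 1) + q * p * k₀
        + ((r : ℤ) + q - q) * (p + 1) * l₀ = (r * (p + 1) + q * p) * (l₀ - b) := by
      rw [hk]
      ring
    rw [hS, hfactor]
    have hq0 : (0 : ℤ) < q := by omega
    have hp0 : (0 : ℤ) < p := by omega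
    exact mul_neg_of_pos_of_neg (by positivity) (by linarith)
end
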